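/- Let Q and Q′ be normal coordinates for germs at 0 of real-analytic hypersurfaces M, M′ ⊂ ℂ², neither Levi-flat near 0, with invariants (α₀, μ₀) and (α₀′, μ₀′), and let H = (F,G) : (ℂ²,0) → (ℂ²,0) be a local biholomorphism satisfying the mapping identity for (Q,Q′); then (α₀,μ₀) = (α₀′,μ₀′), the derivative ∂_z^{α₀}∂_w^{μ₀}G(0) vanishes, and for all χ ∈ ℂ near 0 the identity ∂_wG(0) · q_{α₀μ₀}(χ) = q′_{α₀μ₀}(F̄(χ,0)) · (∂_zF(0) + q_{10}(χ)·∂_wF(0))^{α₀} · (∂_wG(0) − q′_{10}(F̄(χ,0))·∂_wF(0))^{μ₀} holds, where F̄(χ,τ) := conj(F(conj χ, conj τ)). -/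

import Mathlib

open Filter Topology Matrix

noncomputable section

/-- Complex conjugation as a plain function. -/
def cj : ℂ → ℂ := (starRingEnd ℂ)

/-- Iterated partial derivative `∂_z^i ∂_w^j F (z, w)` of `F : ℂ → ℂ → ℂ`. -/
def pd (F : ℂ → ℂ → ℂ) (i j : ℕ) (z w : ℂ) : ℂ :=
  deriv^[i] (fun z' => deriv^[j] (F z') w) z

/-- `Q` is a normal-coordinates defining function (near `0`) of a germ of a
real-analytic hypersurface in `ℂ²`. -/
def IsNormalCoord (Q : ℂ → ℂ → ℂ → ℂ) : Prop :=
  AnalyticAt ℂ (fun p : ℂ × ℂ × ℂ => Q p.1 p.2.1 p.2.2) 0 ∧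
  (∀ᶠ p : ℂ × ℂ in 𝓝 0, Q p.1 0 p.2 = p.2) ∧
  (∀ᶠ p : ℂ × ℂ in 𝓝 0, Q 0 p.1 p.2 = p.2) ∧
  (∀ᶠ p : ℂ × ℂ × ℂ in 𝓝 0, Q p.1 p.2.1 (cj (Q (cj p.2.1) (cj p.1) (cj p.2.2))) = p.2.2)

/-- The mapping identity expressing that the germ at `0` of the holomorphic map
`H = (F, G)` (with `H(0) = 0`) sends the hypersurface defined by `Q` into the one
defined by `Q'`. -/
def SendsInto (Q Q' : ℂ → ℂ → ℂ → ℂ) (F G : ℂ → ℂ → ℂ) : Prop :=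
  AnalyticAt ℂ (fun p : ℂ × ℂ => F p.1 p.2) 0 ∧
  AnalyticAt ℂ (fun p : ℂ × ℂ => G p.1 p.2) 0 ∧
  F 0 0 = 0 ∧ G 0 0 = 0 ∧
  ∀ᶠ p : ℂ × ℂ × ℂ in 𝓝 0,
    G p.1 (Q p.1 p.2.1 p.2.2) =
      Q' (F p.1 (Q p.1 p.2.1 p.2.2)) (cj (F (cj p.2.1) (cj p.2.2))) (cj (G (cj p.2.1) (cj p.2.2)))

/-- Determinant of the Jacobian matrix of `H = (F, G)` at `0`. -/
def JacDet (F G : ℂ → ℂ → ℂ) : ℂ :=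
  pd F 1 0 0 0 * pd G 0 1 0 0 - pd F 0 1 0 0 * pd G 1 0 0 0

/-- The hypersurface defined by `Q` is not Levi-flat near `0`, i.e. `Q(z,χ,τ) ≢ τ`. -/
def NotLeviFlat (Q : ℂ → ℂ → ℂ → ℂ) : Prop :=
  ¬ ∀ᶠ p : ℂ × ℂ × ℂ in 𝓝 0, Q p.1 p.2.1 p.2.2 = p.2.2

/-- The hypersurface defined by `Q` is of finite type at `0`, i.e. `Q(z,χ,0) ≢ 0`. -/
def FiniteTypeAt (Q : ℂ → ℂ → ℂ → ℂ) : Prop :=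
  ¬ ∀ᶠ p : ℂ × ℂ in 𝓝 0, Q p.1 p.2 0 = 0

/-- `q_{αμ}(χ) = ∂_z^α ∂_τ^μ Q(0, χ, 0)`. -/
def qd (Q : ℂ → ℂ → ℂ → ℂ) (α μ : ℕ) (χ : ℂ) : ℂ :=
  deriv^[α] (fun z => deriv^[μ] (fun τ => Q z χ τ) 0) 0

/-- The hypersurface (germ) defined by `Q` as a subset of `ℂ²`. -/
def MSet (Q : ℂ → ℂ → ℂ → ℂ) : Set (ℂ × ℂ) := {p | p.2 = Q p.1 (cj p.1) (cj p.2)}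


/-- `q_{αμ} ≢ 0` as a germ at `0`. -/
def QNontriv (Q : ℂ → ℂ → ℂ → ℂ) (α μ : ℕ) : Prop :=
  ¬ ∀ᶠ χ : ℂ in 𝓝 0, qd Q α μ χ = 0

/-- `(α₀, μ₀)` are the invariants of the (non-Levi-flat) hypersurface defined by `Q`. -/
def IsInvariants (Q : ℂ → ℂ → ℂ → ℂ) (α₀ μ₀ : ℕ) : Prop :=
  1 ≤ α₀ ∧ QNontriv Q α₀ μ₀ ∧
  (∀ α μ : ℕ, 1 ≤ α → QNontriv Q α μ → α₀ + μ₀ ≤ α + μ) ∧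
  (∀ α μ : ℕ, 1 ≤ α → QNontriv Q α μ → α + μ = α₀ + μ₀ → μ₀ ≤ μ)

theorem analyticAt_iterate_deriv {P : Type*} [NormedAddCommGroup P] [NormedSpace ℂ P]
    (n : ℕ) {f : ℂ → P → ℂ} {q : ℂ × P} (hf : AnalyticAt ℂ (fun p : ℂ × P => f p.1 p.2) q) :
    AnalyticAt ℂ (fun p : ℂ × P => deriv^[n] (fun z => f z p.2) p.1) q := by
  induction n generalizing f with
  | zero => exact hf
  | succ n ih =>
    simp only [Function.iterate_succ, Function.comp]
    refine ih (f := fun z p => deriv (fun z => f z p) z) ?_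
    have h1 : AnalyticAt ℂ (fun p : ℂ × P => fderiv ℂ (fun p : ℂ × P => f p.1 p.2) p (1, 0)) q :=
      ((ContinuousLinearMap.apply ℂ ℂ ((1 : ℂ), (0 : P))).analyticAt _).comp hf.fderiv
    refine h1.congr ?_
    filter_upwards [hf.eventually_analyticAt] with p hp
    have h2 : HasDerivAt (fun z : ℂ => (z, p.2)) ((1 : ℂ), (0 : P)) p.1 :=
      (hasDerivAt_id p.1).prodMk (hasDerivAt_const _ _)
    exact (HasFDerivAt.comp_hasDerivAt (f := fun z : ℂ => (z, p.2)) p.1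
      hp.differentiableAt.hasFDerivAt h2).deriv.symm

theorem taylor_isBigO {P : Type*} [NormedAddCommGroup P] [NormedSpace ℂ P]
    (M : ℕ) {f : ℂ → P → ℂ} {p₀ : P}
    (hf : AnalyticAt ℂ (fun p : ℂ × P => f p.1 p.2) (0, p₀)) :
    (fun p : ℂ × P => f p.1 p.2 -
      ∑ n ∈ Finset.range M, deriv^[n] (fun z => f z p.2) 0 / n.factorial * p.1 ^ n)
      =O[𝓝 (0, p₀)] fun p => ‖p.1‖ ^ M := by
  induction M generalizing f with
  | zero => simpa using hf.continuousAt.norm.isBoundedUnder_le.isBigO_one ℝ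
  | succ M ih =>
    have h1 := ih (f := fun z p => deriv (fun z => f z p) z) (analyticAt_iterate_deriv 1 hf)
    obtain ⟨C, hC0, hC⟩ := h1.exists_pos
    have h2 := hC.bound.and hf.eventually_analyticAt
    rw [Metric.eventually_nhds_iff_ball] at h2
    obtain ⟨ε, hε, h2⟩ := h2
    refine Asymptotics.IsBigO.of_bound C ?_
    filter_upwards [Metric.ball_mem_nhds _ hε] with p hp
    have hp' : ‖p.1‖ < ε ∧ dist p.2 p₀ < ε := by
      simpa [Prod.dist_eq] using hp
    have key : ∀ z ∈ Metric.closedBall (0 : ℂ) ‖p.1‖, HasDerivAt (fun z => f z p.2 -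
        ∑ n ∈ Finset.range (M + 1), deriv^[n] (fun z => f z p.2) 0 / n.factorial * z ^ n)
        (deriv (fun z => f z p.2) z - ∑ n ∈ Finset.range M,
          deriv^[n] (fun z => deriv (fun z => f z p.2) z) 0 / n.factorial * z ^ n) z ∧
        ‖deriv (fun z => f z p.2) z - ∑ n ∈ Finset.range M,
          deriv^[n] (fun z => deriv (fun z => f z p.2) z) 0 / n.factorial * z ^ n‖
          ≤ C * ‖p.1‖ ^ M := by
      intro z hz
      have hz' : ‖z‖ ≤ ‖p.1‖ := by simpa using hz
      have h3 := h2 (z, p.2) (by simp [Prod.dist_eq]; exact ⟨hz'.trans_lt hp'.1, hp'.2⟩)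
      have hA : AnalyticAt ℂ (fun z => f z p.2) z :=
        AnalyticAt.fun_comp (g := fun p : ℂ × P => f p.1 p.2) (f := fun z => (z, p.2)) h3.2
          (analyticAt_id.prod analyticAt_const)
      constructor
      · refine hA.differentiableAt.hasDerivAt.sub ?_
        have := HasDerivAt.fun_sum (u := Finset.range (M + 1))
          (A := fun n z => deriv^[n] (fun z => f z p.2) 0 / n.factorial * z ^ n)
          (A' := fun n => deriv^[n] (fun z => f z p.2) 0 / n.factorial * (n * z ^ (n - 1)))
          (x := z) (fun n _ => (hasDerivAt_pow n z).const_mul _)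
        convert this using 1
        rw [Finset.sum_range_succ', ← add_zero (∑ n ∈ Finset.range M, _)]
        congr 1
        · refine Finset.sum_congr rfl fun n _ => ?_
          have h0 : (n.factorial : ℂ) ≠ 0 := by exact_mod_cast n.factorial_ne_zero
          have h0' : (n : ℂ) + 1 ≠ 0 := by exact_mod_cast n.succ_ne_zero
          simp only [Function.iterate_succ, Function.comp, Nat.factorial_succ]
          push_cast
          field_simp
        · simp
      · refine h3.1.trans ?_
        rw [norm_pow, norm_norm]
        gcongr
    have := Convex.norm_image_sub_le_of_norm_hasDerivWithin_le
      (fun z hz => (key z hz).1.hasDerivWithinAt) (fun z hz => (key z hz).2)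
      (convex_closedBall (0 : ℂ) ‖p.1‖) (x := 0) (y := p.1) (by simp) (by simp)
    have e0 : f 0 p.2 - ∑ n ∈ Finset.range (M + 1),
        deriv^[n] (fun z => f z p.2) 0 / n.factorial * 0 ^ n = 0 := by
      rw [Finset.sum_range_succ']; simp
    rw [e0, sub_zero, sub_zero] at this
    rw [Real.norm_of_nonneg (by positivity), pow_succ, ← mul_assoc]
    exact this

theorem analyticAt_rotate {f : ℂ → ℂ → ℂ → ℂ}
    (hf : AnalyticAt ℂ (fun p : ℂ × ℂ × ℂ => f p.1 p.2.1 p.2.2) 0) :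
    AnalyticAt ℂ (fun p : ℂ × ℂ × ℂ => f p.2.1 p.2.2 p.1) 0 := by
  have h : AnalyticAt ℂ (fun p : ℂ × ℂ × ℂ => (p.2.1, p.2.2, p.1)) 0 :=
    (((ContinuousLinearMap.fst ℂ ℂ ℂ).comp (ContinuousLinearMap.snd ℂ ℂ (ℂ × ℂ))).prod
      (((ContinuousLinearMap.snd ℂ ℂ ℂ).comp (ContinuousLinearMap.snd ℂ ℂ (ℂ × ℂ))).prod
        (ContinuousLinearMap.fst ℂ ℂ (ℂ × ℂ)))).analyticAt 0
  exact AnalyticAt.fun_comp_of_eq (g := fun p : ℂ × ℂ × ℂ => f p.1 p.2.1 p.2.2) hf h rfl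

theorem analyticAt_qd {f : ℂ → ℂ → ℂ → ℂ}
    (hf : AnalyticAt ℂ (fun p : ℂ × ℂ × ℂ => f p.1 p.2.1 p.2.2) 0) (α μ : ℕ) :
    AnalyticAt ℂ (fun p : ℂ × ℂ => deriv^[μ] (fun τ => f p.1 p.2 τ) 0) 0 ∧
      AnalyticAt ℂ (qd f α μ) 0 := by
  have h1 := analyticAt_rotate hf
  have h2 := analyticAt_iterate_deriv μ (f := fun τ (p : ℂ × ℂ) => f p.1 p.2 τ) h1
  have h3 : AnalyticAt ℂ (fun p : ℂ × ℂ => deriv^[μ] (fun τ => f p.1 p.2 τ) 0) 0 := by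
    have : AnalyticAt ℂ (fun p : ℂ × ℂ => ((0 : ℂ), p)) 0 := by fun_prop
    exact AnalyticAt.fun_comp_of_eq
      (g := fun q : ℂ × ℂ × ℂ => deriv^[μ] (fun τ => f q.2.1 q.2.2 τ) q.1) h2 this rfl
  refine ⟨h3, ?_⟩
  have h4 := analyticAt_iterate_deriv α
    (f := fun z χ => deriv^[μ] (fun τ => f z χ τ) 0) (q := (0, 0)) h3
  have : AnalyticAt ℂ (fun χ : ℂ => ((0 : ℂ), χ)) 0 := by fun_prop
  exact AnalyticAt.fun_comp_of_eq
    (g := fun q : ℂ × ℂ => deriv^[α] (fun z => deriv^[μ] (fun τ => f z q.2 τ) 0) q.1) h4 this rfl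

/-- Taylor expansion in `(z, τ)`, uniform in the middle variable. -/
theorem taylor_qd_isBigO {f : ℂ → ℂ → ℂ → ℂ}
    (hf : AnalyticAt ℂ (fun p : ℂ × ℂ × ℂ => f p.1 p.2.1 p.2.2) 0) (M : ℕ) :
    (fun p : ℂ × ℂ × ℂ => f p.1 p.2.1 p.2.2 -
      ∑ μ ∈ Finset.range M, ∑ α ∈ Finset.range M,
        qd f α μ p.2.1 / (α.factorial * μ.factorial) * p.1 ^ α * p.2.2 ^ μ)
      =O[𝓝 0] fun p => ‖p.1‖ ^ M + ‖p.2.2‖ ^ M := by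
  have h1 := analyticAt_rotate hf
  have h2 := taylor_isBigO M (f := fun τ (p : ℂ × ℂ) => f p.1 p.2 τ) (p₀ := 0) h1
  have t1 : Tendsto (fun p : ℂ × ℂ × ℂ => (p.2.2, p.1, p.2.1)) (𝓝 0) (𝓝 (0, 0)) :=
    Continuous.tendsto' (by fun_prop) _ _ rfl
  have h3 := h2.comp_tendsto t1
  have h4 : ∀ μ ∈ Finset.range M, (fun p : ℂ × ℂ × ℂ =>
      (deriv^[μ] (fun τ => f p.1 p.2.1 τ) 0 -
        ∑ α ∈ Finset.range M, qd f α μ p.2.1 / α.factorial * p.1 ^ α) / μ.factorial * p.2.2 ^ μ)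
      =O[𝓝 0] fun p => ‖p.1‖ ^ M := by
    intro μ _
    have h5 := taylor_isBigO M (f := fun z χ => deriv^[μ] (fun τ => f z χ τ) 0) (p₀ := 0)
      (analyticAt_qd hf 0 μ).1
    have t2 : Tendsto (fun p : ℂ × ℂ × ℂ => (p.1, p.2.1)) (𝓝 0) (𝓝 (0, 0)) :=
      Continuous.tendsto' (by fun_prop) _ _ rfl
    have h6 := h5.comp_tendsto t2
    have h7 : (fun p : ℂ × ℂ × ℂ => p.2.2 ^ μ / μ.factorial) =O[𝓝 0] fun _ => (1 : ℝ) := by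
      have : ContinuousAt (fun p : ℂ × ℂ × ℂ => p.2.2 ^ μ / (μ.factorial : ℂ)) 0 := by fun_prop
      exact this.norm.isBoundedUnder_le.isBigO_one ℝ
    refine (h6.mul h7).congr (fun p => ?_) (fun p => ?_)
    · simp only [Function.comp, qd]; ring
    · simp
  have h8 := Asymptotics.IsBigO.sum h4
  have h9 : (fun p : ℂ × ℂ × ℂ => ‖p.1‖ ^ M) =O[𝓝 0] fun p => ‖p.1‖ ^ M + ‖p.2.2‖ ^ M := by
    refine Asymptotics.IsBigO.of_norm_le fun p => ?_
    rw [Real.norm_of_nonneg (by positivity)]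
    exact le_add_of_nonneg_right (by positivity)
  have h10 : (fun p : ℂ × ℂ × ℂ => ‖p.2.2‖ ^ M) =O[𝓝 0] fun p => ‖p.1‖ ^ M + ‖p.2.2‖ ^ M := by
    refine Asymptotics.IsBigO.of_norm_le fun p => ?_
    rw [Real.norm_of_nonneg (by positivity)]
    exact le_add_of_nonneg_left (by positivity)
  refine ((h3.trans h10).add (h8.trans h9)).congr_left fun p => ?_
  simp only [Function.comp]
  rw [sub_add_eq_add_sub, add_sub_assoc, sub_eq_add_neg (f _ _ _)]
  congr 1
  rw [Finset.sum_apply, ← Finset.sum_sub_distrib, ← Finset.sum_neg_distrib]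
  refine Finset.sum_congr rfl fun μ _ => ?_
  rw [sub_div, sub_mul, sub_sub_cancel_left, Finset.sum_div, Finset.sum_mul]
  congr 1
  refine Finset.sum_congr rfl fun α _ => ?_
  ring

/-- The coefficients `q_{αμ}` with `α ≥ 1` preceding `(a, b)` (ordered by `α + μ`, then `μ`)
vanish near `0`. -/
def VanishBelow (f : ℂ → ℂ → ℂ → ℂ) (a b : ℕ) : Prop :=
  ∀ α μ : ℕ, 1 ≤ α → (α + μ < a + b ∨ α + μ = a + b ∧ μ < b) → ∀ᶠ χ : ℂ in 𝓝 0, qd f α μ χ = 0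

/-- Weighted leading term of `f` along curves `z ~ t ^ N`, `τ ~ t ^ (N + 1)`, `N = a + b + 1`. -/
theorem tendsto_weighted {f : ℂ → ℂ → ℂ → ℂ}
    (hf : AnalyticAt ℂ (fun p : ℂ × ℂ × ℂ => f p.1 p.2.1 p.2.2) 0) {a b : ℕ} (ha : 1 ≤ a)
    (hv : VanishBelow f a b) :
    ∀ᶠ χ : ℂ in 𝓝 0, ∀ (Z X W : ℂ → ℂ) (A B : ℂ),
      Tendsto (fun t => Z t / t ^ (a + b + 1)) (𝓝[≠] 0) (𝓝 A) →
      Tendsto (fun t => W t / t ^ (a + b + 2)) (𝓝[≠] 0) (𝓝 B) →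
      Tendsto X (𝓝[≠] 0) (𝓝 χ) →
      Tendsto (fun t => (f (Z t) (X t) (W t) - f 0 (X t) (W t)) /
          t ^ ((a + b + 1) * (a + b) + b)) (𝓝[≠] 0)
        (𝓝 (qd f a b χ / (a.factorial * b.factorial) * A ^ a * B ^ b)) := by
  set N := a + b + 1 with hN
  obtain ⟨C, -, hC⟩ := (taylor_qd_isBigO hf N).exists_pos
  have c1 : Tendsto (fun χ : ℂ => ((0 : ℂ), χ, (0 : ℂ))) (𝓝 0) (𝓝 0) :=
    Continuous.tendsto' (by fun_prop) _ _ rfl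
  have hC1 := c1.eventually hC.bound.eventually_nhds
  have hcont : ∀ᶠ χ : ℂ in 𝓝 0, ∀ μ ∈ Finset.range N, ∀ α ∈ Finset.range N,
      ContinuousAt (qd f α μ) χ := by
    simp only [Filter.eventually_all_finset]
    intro μ _ α _
    filter_upwards [(analyticAt_qd hf α μ).2.eventually_analyticAt] with χ h using h.continuousAt
  have hzero : ∀ᶠ χ : ℂ in 𝓝 0, ∀ μ ∈ Finset.range N, ∀ α ∈ Finset.range N, 1 ≤ α →
      (α + μ < a + b ∨ α + μ = a + b ∧ μ < b) → ∀ᶠ χ' in 𝓝 χ, qd f α μ χ' = 0 := by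
    simp only [Filter.eventually_all_finset, Filter.eventually_all]
    intro μ _ α _ h1 h2
    exact (hv α μ h1 h2).eventually_nhds
  filter_upwards [hC1, hcont, hzero] with χ hCχ hcont hzero Z X W A B hZ hW hX
  have tt : Tendsto (fun t : ℂ => t) (𝓝[≠] 0) (𝓝 0) := nhdsWithin_le_nhds
  have tpow : ∀ n : ℕ, n ≠ 0 → Tendsto (fun t : ℂ => t ^ n) (𝓝[≠] 0) (𝓝 0) := fun n hn => by
    simpa [hn] using tt.pow n
  have hne : ∀ᶠ t : ℂ in 𝓝[≠] 0, t ≠ 0 := eventually_mem_nhdsWithin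
  have hZ0 : Tendsto Z (𝓝[≠] 0) (𝓝 0) := by
    have := hZ.mul (tpow N (by omega))
    rw [mul_zero] at this
    refine this.congr' ?_
    filter_upwards [hne] with t ht
    field_simp
  have hW0 : Tendsto W (𝓝[≠] 0) (𝓝 0) := by
    have := hW.mul (tpow (a + b + 2) (by omega))
    rw [mul_zero] at this
    refine this.congr' ?_
    filter_upwards [hne] with t ht
    field_simp
  have rem : ∀ Z : ℂ → ℂ, ∀ A, Tendsto (fun t => Z t / t ^ N) (𝓝[≠] 0) (𝓝 A) →
      Tendsto Z (𝓝[≠] 0) (𝓝 0) → Tendsto (fun t => (f (Z t) (X t) (W t) -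
      ∑ μ ∈ Finset.range N, ∑ α ∈ Finset.range N,
        qd f α μ (X t) / (α.factorial * μ.factorial) * (Z t) ^ α * (W t) ^ μ) /
          t ^ (N * (a + b) + b)) (𝓝[≠] 0) (𝓝 0) := by
    intro Z A hZ hZ0
    have hp : Tendsto (fun t => (Z t, X t, W t)) (𝓝[≠] 0) (𝓝 (0, χ, 0)) :=
      hZ0.prodMk_nhds (hX.prodMk_nhds hW0)
    have hb := hp.eventually hCχ
    have hlim : Tendsto (fun t : ℂ => C * (‖Z t / t ^ N‖ ^ N + ‖W t / t ^ (a + b + 2)‖ ^ N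
        * ‖t‖ ^ N) * ‖t‖ ^ (a + 1)) (𝓝[≠] 0) (𝓝 0) := by
      have ht0 : Tendsto (fun t : ℂ => ‖t‖) (𝓝[≠] 0) (𝓝 0) := by simpa using tt.norm
      have := ((hZ.norm.pow N).add ((hW.norm.pow N).mul (ht0.pow N))).const_mul C |>.mul
        (ht0.pow (a + 1))
      simpa using this
    refine squeeze_zero_norm' ?_ hlim
    filter_upwards [hb, hne] with t hb ht
    have ht' : 0 < ‖t‖ := norm_pos_iff.2 ht
    rw [norm_div, norm_pow, div_le_iff₀ (by positivity)]
    refine hb.trans (le_of_eq ?_)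
    rw [Real.norm_of_nonneg (by positivity), norm_div, norm_div, norm_pow, norm_pow]
    have e1 : N * (a + b) + b + (a + 1) = N * N := by rw [hN]; ring
    have e2 : (a + b + 2) * N = N * N + N := by rw [hN]; ring
    rw [mul_assoc, ← pow_add, add_comm (a + 1), e1, div_pow, div_pow, ← pow_mul, ← pow_mul, e2,
      pow_add]
    field_simp
    ring
  have r1 := rem Z A hZ hZ0
  have r2 := rem (fun _ => 0) 0 (by simp) tendsto_const_nhds
  have main : Tendsto (fun t => ∑ μ ∈ Finset.range N, ∑ α ∈ Finset.range N,
      qd f α μ (X t) / (α.factorial * μ.factorial) * (Z t ^ α - 0 ^ α) * W t ^ μ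
        / t ^ (N * (a + b) + b)) (𝓝[≠] 0)
      (𝓝 (∑ μ ∈ Finset.range N, ∑ α ∈ Finset.range N, if μ = b then if α = a then
        qd f a b χ / (a.factorial * b.factorial) * A ^ a * B ^ b else 0 else 0)) := by
    refine tendsto_finsetSum _ fun μ hμ => tendsto_finsetSum _ fun α hα => ?_
    rcases Nat.eq_zero_or_pos α with h0 | h0
    · subst h0
      simp [show ¬ (0 = a) by omega]
    by_cases hlow : α + μ < a + b ∨ α + μ = a + b ∧ μ < b
    · have : ¬ (μ = b ∧ α = a) := by omega
      rw [← ite_and, if_neg this]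
      refine tendsto_const_nhds.congr' ?_
      filter_upwards [hX.eventually (hzero μ hμ α hα h0 hlow)] with t ht
      simp [ht]
    have base := ((((hcont μ hμ α hα).tendsto.comp hX).div_const
      ((α.factorial : ℂ) * μ.factorial)).mul (hZ.pow α)).mul (hW.pow μ)
    obtain ⟨e, he⟩ : ∃ e, N * α + (N + 1) * μ = N * (a + b) + b + e := by
      apply Nat.exists_eq_add_of_le
      rcases lt_trichotomy (α + μ) (a + b) with h | h | h
      · omega
      · nlinarith [Nat.le_of_not_lt (fun h' => hlow (Or.inr ⟨h, h'⟩))]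
      · nlinarith
    have hfun : ∀ᶠ t in 𝓝[≠] 0, ((qd f α μ ∘ X) t / (α.factorial * μ.factorial) *
        (Z t / t ^ N) ^ α * (W t / t ^ (a + b + 2)) ^ μ) * t ^ e =
        qd f α μ (X t) / (α.factorial * μ.factorial) * (Z t ^ α - 0 ^ α) * W t ^ μ
        / t ^ (N * (a + b) + b) := by
      filter_upwards [hne] with t ht
      have : t ^ e = t ^ (N * α) * t ^ ((a + b + 2) * μ) / t ^ (N * (a + b) + b) := by
        rw [← pow_add, show a + b + 2 = N + 1 by omega, he, pow_add]
        field_simp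
      rw [this, div_pow, div_pow, ← pow_mul, ← pow_mul, zero_pow (by omega), sub_zero]
      simp only [Function.comp]
      field_simp
    by_cases heq : μ = b ∧ α = a
    · obtain ⟨rfl, rfl⟩ := heq
      have : e = 0 := by nlinarith
      subst this
      simp only [pow_zero, mul_one] at hfun
      simpa using base.congr' hfun
    · rw [← ite_and, if_neg heq]
      have he0 : e ≠ 0 := by
        rintro rfl
        apply heq
        have : α + μ = a + b := by
          rcases lt_trichotomy (α + μ) (a + b) with h | h | h
          · omega
          · exact h
          · nlinarith
        have : μ = b := by nlinarith
        omega
      simpa using (base.mul (tpow e he0)).congr' hfun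
  have key : ∑ μ ∈ Finset.range N, ∑ α ∈ Finset.range N, (if μ = b then if α = a then
        qd f a b χ / (a.factorial * b.factorial) * A ^ a * B ^ b else 0 else 0) =
        qd f a b χ / (a.factorial * b.factorial) * A ^ a * B ^ b := by
    rw [Finset.sum_eq_single_of_mem b (by simp; omega), Finset.sum_eq_single_of_mem a
      (by simp; omega)]
    · simp
    · intro α _ h; simp [h]
    · intro μ _ h; simp [h]
  rw [key] at main
  have := main.add (r1.sub r2)
  rw [sub_zero, add_zero] at this
  refine this.congr fun t => ?_
  simp only [← Finset.sum_div, ← add_div, ← sub_div, mul_sub, sub_mul, Finset.sum_sub_distrib]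
  congr 1
  ring

@[simp] theorem cj_zero : cj 0 = 0 := map_zero _

theorem continuous_cj : Continuous cj := Complex.continuous_conj

theorem cj_cj (x : ℂ) : cj (cj x) = x := Complex.conj_conj x

theorem qd_zero_of_normal {Q : ℂ → ℂ → ℂ → ℂ} (h : ∀ᶠ p : ℂ × ℂ in 𝓝 0, Q p.1 0 p.2 = p.2)
    {α : ℕ} (hα : 1 ≤ α) (μ : ℕ) : qd Q α μ 0 = 0 := by
  have h1 : (fun z => deriv^[μ] (fun τ => Q z 0 τ) 0) =ᶠ[𝓝 0] fun _ => iteratedDeriv μ id 0 := by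
    have h2 : ∀ᶠ z : ℂ in 𝓝 0, ∀ᶠ τ : ℂ in 𝓝 0, Q z 0 τ = τ :=
      Filter.Eventually.curry_nhds (x := (0 : ℂ)) (y := (0 : ℂ))
        (p := fun p : ℂ × ℂ => Q p.1 0 p.2 = p.2) h
    filter_upwards [h2] with z hz
    rw [← iteratedDeriv_eq_iterate]
    exact Filter.EventuallyEq.iteratedDeriv_eq μ hz
  rw [qd, ← iteratedDeriv_eq_iterate, h1.iteratedDeriv_eq, iteratedDeriv_const,
    if_neg (by omega)]

theorem fderiv_apply_eq_pd {F : ℂ → ℂ → ℂ}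
    (hF : AnalyticAt ℂ (fun p : ℂ × ℂ => F p.1 p.2) 0) (u v : ℂ) :
    fderiv ℂ (fun p : ℂ × ℂ => F p.1 p.2) 0 (u, v) = pd F 1 0 0 0 * u + pd F 0 1 0 0 * v := by
  have hd := hF.differentiableAt.hasFDerivAt
  have h1 : HasDerivAt (fun z : ℂ => (z, (0 : ℂ))) (1, 0) 0 :=
    (hasDerivAt_id _).prodMk (hasDerivAt_const _ _)
  have h2 : HasDerivAt (fun z : ℂ => ((0 : ℂ), z)) (0, 1) 0 :=
    (hasDerivAt_const _ _).prodMk (hasDerivAt_id _)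
  have e1 : pd F 1 0 0 0 = fderiv ℂ (fun p : ℂ × ℂ => F p.1 p.2) 0 (1, 0) :=
    (HasFDerivAt.comp_hasDerivAt (f := fun z : ℂ => (z, (0 : ℂ))) 0 hd h1).deriv
  have e2 : pd F 0 1 0 0 = fderiv ℂ (fun p : ℂ × ℂ => F p.1 p.2) 0 (0, 1) :=
    (HasFDerivAt.comp_hasDerivAt (f := fun z : ℂ => ((0 : ℂ), z)) 0 hd h2).deriv
  have e3 : ((u, v) : ℂ × ℂ) = u • (1, 0) + v • (0, 1) := by simp
  rw [e3, map_add, map_smul, map_smul, e1, e2, smul_eq_mul, smul_eq_mul]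
  ring

theorem tendsto_div_of_analyticAt {F : ℂ → ℂ → ℂ}
    (hF : AnalyticAt ℂ (fun p : ℂ × ℂ => F p.1 p.2) 0) (hF0 : F 0 0 = 0)
    {l : Filter ℂ} {x y c : ℂ → ℂ} {u v : ℂ} (hx : Tendsto x l (𝓝 0)) (hy : Tendsto y l (𝓝 0))
    (hu : Tendsto (fun t => x t / c t) l (𝓝 u)) (hv : Tendsto (fun t => y t / c t) l (𝓝 v)) :
    Tendsto (fun t => F (x t) (y t) / c t) l (𝓝 (pd F 1 0 0 0 * u + pd F 0 1 0 0 * v)) := by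
  rw [← fderiv_apply_eq_pd hF]
  have h1 := HasFDerivWithinAt.lim (s := Set.univ) (c := fun t => (c t)⁻¹)
    (d := fun t => (x t, y t)) (v := (u, v)) hF.differentiableAt.hasFDerivAt.hasFDerivWithinAt
    (hx.prodMk_nhds hy) (by simp)
    ((hu.prodMk_nhds hv).congr fun t => by simp [div_eq_inv_mul])
  refine h1.congr fun t => ?_
  simp [hF0, div_eq_inv_mul]

theorem tendsto_pow_punctured {n : ℕ} (hn : n ≠ 0) :
    Tendsto (fun t : ℂ => t ^ n) (𝓝[≠] 0) (𝓝[≠] 0) := by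
  refine tendsto_nhdsWithin_iff.2 ⟨?_, ?_⟩
  · exact (Continuous.tendsto' (by fun_prop) _ _ (by simp [hn])).mono_left nhdsWithin_le_nhds
  · filter_upwards [eventually_mem_nhdsWithin] with t ht using pow_ne_zero n ht

theorem tendsto_pow_div_pow {m n : ℕ} (h : n < m) :
    Tendsto (fun t : ℂ => t ^ m / t ^ n) (𝓝[≠] 0) (𝓝 0) := by
  have := (tendsto_pow_punctured (n := m - n) (by omega)).mono_right nhdsWithin_le_nhds
  refine this.congr' ?_
  filter_upwards [eventually_mem_nhdsWithin] with t ht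
  have ht : t ≠ 0 := ht
  rw [pow_sub₀ _ ht h.le, div_eq_mul_inv]

theorem tendsto_pow_div_self {n : ℕ} :
    Tendsto (fun t : ℂ => t ^ n / t ^ n) (𝓝[≠] 0) (𝓝 1) := by
  refine tendsto_const_nhds.congr' ?_
  filter_upwards [eventually_mem_nhdsWithin] with t ht
  have ht : t ≠ 0 := ht
  field_simp

theorem tendsto_cj_div {g : ℂ → ℂ} (hg : DifferentiableAt ℂ g 0) (hg0 : g 0 = 0) {n : ℕ}
    (hn : n ≠ 0) : Tendsto (fun t : ℂ => cj (g (cj (t ^ n))) / t ^ n) (𝓝[≠] 0)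
      (𝓝 (cj (deriv g 0))) := by
  have h1 := hasDerivAt_iff_tendsto_slope.1 hg.hasDerivAt
  have h2 : Tendsto cj (𝓝[≠] 0) (𝓝[≠] 0) := by
    refine tendsto_nhdsWithin_iff.2 ⟨?_, ?_⟩
    · exact (continuous_cj.tendsto' _ _ cj_zero).mono_left nhdsWithin_le_nhds
    · filter_upwards [eventually_mem_nhdsWithin] with t ht h
      exact ht (by rw [Set.mem_singleton_iff, ← cj_cj t, h, cj_zero])
  have h3 := (continuous_cj.tendsto _).comp (h1.comp (h2.comp (tendsto_pow_punctured hn)))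
  refine h3.congr fun t => ?_
  simp [slope, hg0, cj, div_eq_inv_mul]

theorem map_zero_second {Q Q' : ℂ → ℂ → ℂ → ℂ} (hQ : IsNormalCoord Q) (hQ' : IsNormalCoord Q')
    {F G : ℂ → ℂ → ℂ} (h : SendsInto Q Q' F G) : ∀ᶠ z : ℂ in 𝓝 0, G z 0 = 0 := by
  obtain ⟨hF, hG, hF0, hG0, hmap⟩ := h
  have c1 : Tendsto (fun z : ℂ => (z, (0 : ℂ), (0 : ℂ))) (𝓝 0) (𝓝 0) :=
    Continuous.tendsto' (by fun_prop) _ _ rfl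
  have c2 : Tendsto (fun z : ℂ => (z, (0 : ℂ))) (𝓝 0) (𝓝 0) :=
    Continuous.tendsto' (by fun_prop) _ _ rfl
  have c3 : Tendsto (fun z : ℂ => (F z 0, (0 : ℂ))) (𝓝 0) (𝓝 0) := by
    have : Tendsto (fun z : ℂ => F z 0) (𝓝 0) (𝓝 0) := by
      have := hF.continuousAt.tendsto.comp c2
      simpa [Function.comp_def, hF0] using this
    exact this.prodMk_nhds tendsto_const_nhds
  filter_upwards [c1.eventually hmap, c2.eventually hQ.2.1, c3.eventually hQ'.2.1] with z h1 h2 h3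
  rw [h2, cj_zero, hF0, hG0, cj_zero, h3] at h1
  exact h1

theorem tendsto_reflection {Q Q' : ℂ → ℂ → ℂ → ℂ} (hQ : IsNormalCoord Q)
    (hQ' : IsNormalCoord Q') {F G : ℂ → ℂ → ℂ} (h : SendsInto Q Q' F G) {a b : ℕ} (ha : 1 ≤ a)
    (hv : VanishBelow Q a b) (hv' : VanishBelow Q' a b) :
    ∀ᶠ χ : ℂ in 𝓝 0,
      Tendsto (fun t => Q (t ^ (a + b + 1)) χ (t ^ (a + b + 2))) (𝓝[≠] 0) (𝓝 0) ∧
      Tendsto (fun t => (Q (t ^ (a + b + 1)) χ (t ^ (a + b + 2)) - t ^ (a + b + 2)) /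
        t ^ ((a + b + 1) * (a + b) + b)) (𝓝[≠] 0)
        (𝓝 (qd Q a b χ / (a.factorial * b.factorial))) ∧
      Tendsto (fun t => (G (t ^ (a + b + 1)) (Q (t ^ (a + b + 1)) χ (t ^ (a + b + 2))) -
          cj (G (cj χ) (cj (t ^ (a + b + 2))))) / t ^ ((a + b + 1) * (a + b) + b)) (𝓝[≠] 0)
        (𝓝 (qd Q' a b (cj (F (cj χ) 0)) / (a.factorial * b.factorial) *
          (pd F 1 0 0 0 + qd Q 1 0 χ * pd F 0 1 0 0) ^ a * cj (deriv (G (cj χ)) 0) ^ b)) ∧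
      Tendsto (fun t => (G 0 (t ^ (a + b + 2)) - cj (G (cj χ) (cj (t ^ (a + b + 2))))) /
        t ^ ((a + b + 1) * (a + b) + b)) (𝓝[≠] 0) (𝓝 0) ∧
      Tendsto (fun t => cj (G (cj χ) (cj (t ^ (a + b + 2)))) / t ^ (a + b + 2)) (𝓝[≠] 0)
        (𝓝 (cj (deriv (G (cj χ)) 0))) := by
  have hGz := map_zero_second hQ hQ' h
  obtain ⟨hF, hG, hF0, hG0, hmap⟩ := h
  have tcj : Tendsto cj (𝓝 0) (𝓝 0) := continuous_cj.tendsto' _ _ cj_zero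
  have tcj0 : Tendsto (fun χ => (cj χ, (0 : ℂ))) (𝓝 0) (𝓝 0) := tcj.prodMk_nhds tendsto_const_nhds
  have tf : Tendsto (fun χ => cj (F (cj χ) 0)) (𝓝 0) (𝓝 0) := by
    have := (continuous_cj.tendsto _).comp (hF.continuousAt.tendsto.comp tcj0)
    simpa [Function.comp_def, hF0] using this
  have tf0 : Tendsto (fun χ => (cj (F (cj χ) 0), (0 : ℂ))) (𝓝 0) (𝓝 0) :=
    tf.prodMk_nhds tendsto_const_nhds
  have t3 : Tendsto (fun χ : ℂ => ((0 : ℂ), χ, (0 : ℂ))) (𝓝 0) (𝓝 0) :=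
    Continuous.tendsto' (by fun_prop) _ _ rfl
  have t2 : Tendsto (fun χ : ℂ => (χ, (0 : ℂ))) (𝓝 0) (𝓝 0) :=
    Continuous.tendsto' (by fun_prop) _ _ rfl
  have hq10 : ∀ᶠ χ : ℂ in 𝓝 0, 1 < a + b → qd Q 1 0 χ = 0 := by
    by_cases hk : 1 < a + b
    · filter_upwards [hv 1 0 le_rfl (Or.inl hk)] with χ h _ using h
    · simp [hk]
  filter_upwards [tendsto_weighted hQ.1 ha hv, tf.eventually (tendsto_weighted hQ'.1 ha hv'),
    t3.eventually hmap.eventually_nhds, t2.eventually hQ.2.2.1.eventually_nhds,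
    tf0.eventually hQ'.2.2.1.eventually_nhds, tcj.eventually hGz,
    tcj0.eventually hF.eventually_analyticAt, tcj0.eventually hG.eventually_analyticAt, hq10]
    with χ hL hL' hmapχ hnorm hnorm' hGχ hFan hGan hq10
  have hne : ∀ᶠ t : ℂ in 𝓝[≠] 0, t ≠ 0 := eventually_mem_nhdsWithin
  have tz : Tendsto (fun t : ℂ => t ^ (a + b + 1)) (𝓝[≠] 0) (𝓝 0) :=
    (tendsto_pow_punctured (by omega)).mono_right nhdsWithin_le_nhds
  have tτ : Tendsto (fun t : ℂ => t ^ (a + b + 2)) (𝓝[≠] 0) (𝓝 0) :=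
    (tendsto_pow_punctured (by omega)).mono_right nhdsWithin_le_nhds
  have tcτ : Tendsto (fun t : ℂ => (cj χ, cj (t ^ (a + b + 2)))) (𝓝[≠] 0) (𝓝 (cj χ, 0)) :=
    tendsto_const_nhds.prodMk_nhds (tcj.comp tτ)
  have evn : ∀ᶠ t : ℂ in 𝓝[≠] 0, Q 0 χ (t ^ (a + b + 2)) = t ^ (a + b + 2) :=
    (tendsto_const_nhds.prodMk_nhds tτ).eventually hnorm
  have TQ : Tendsto (fun t => (Q (t ^ (a + b + 1)) χ (t ^ (a + b + 2)) - t ^ (a + b + 2)) /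
        t ^ ((a + b + 1) * (a + b) + b)) (𝓝[≠] 0)
        (𝓝 (qd Q a b χ / (a.factorial * b.factorial))) := by
    have := hL (fun t => t ^ (a + b + 1)) (fun _ => χ) (fun t => t ^ (a + b + 2)) 1 1
      tendsto_pow_div_self tendsto_pow_div_self tendsto_const_nhds
    rw [one_pow, one_pow, mul_one, mul_one] at this
    refine this.congr' ?_
    filter_upwards [evn] with t ht
    rw [ht]
  have TQN : Tendsto (fun t => Q (t ^ (a + b + 1)) χ (t ^ (a + b + 2)) / t ^ (a + b + 1))
      (𝓝[≠] 0) (𝓝 (qd Q 1 0 χ)) := by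
    have hdiff : Tendsto (fun t => (Q (t ^ (a + b + 1)) χ (t ^ (a + b + 2)) - t ^ (a + b + 2)) /
        t ^ (a + b + 1)) (𝓝[≠] 0) (𝓝 (qd Q 1 0 χ)) := by
      by_cases hk : 1 < a + b
      · rw [hq10 hk]
        have := TQ.mul (tendsto_pow_div_pow (m := (a + b + 1) * (a + b) + b) (n := a + b + 1)
          (by nlinarith))
        rw [mul_zero] at this
        refine this.congr' ?_
        filter_upwards [hne] with t ht
        field_simp
      · obtain ⟨rfl, rfl⟩ : a = 1 ∧ b = 0 := by omega
        simpa using TQ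
    have := hdiff.add (tendsto_pow_div_pow (m := a + b + 2) (n := a + b + 1) (by omega))
    rw [add_zero] at this
    refine this.congr fun t => ?_
    rw [← add_div, sub_add_cancel]
  have Tw : Tendsto (fun t => Q (t ^ (a + b + 1)) χ (t ^ (a + b + 2))) (𝓝[≠] 0) (𝓝 0) := by
    have := TQN.mul tz
    rw [mul_zero] at this
    refine this.congr' ?_
    filter_upwards [hne] with t ht
    field_simp
  have TX : Tendsto (fun t => cj (F (cj χ) (cj (t ^ (a + b + 2))))) (𝓝[≠] 0)
      (𝓝 (cj (F (cj χ) 0))) :=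
    (continuous_cj.tendsto _).comp (hFan.continuousAt.tendsto.comp tcτ)
  have TW : Tendsto (fun t => cj (G (cj χ) (cj (t ^ (a + b + 2)))) / t ^ (a + b + 2)) (𝓝[≠] 0)
        (𝓝 (cj (deriv (G (cj χ)) 0))) := by
    refine tendsto_cj_div ?_ hGχ (by omega)
    exact DifferentiableAt.comp (g := fun p : ℂ × ℂ => G p.1 p.2) (f := fun τ : ℂ => (cj χ, τ)) 0 hGan.differentiableAt
      (by fun_prop)
  have TW0 : Tendsto (fun t => cj (G (cj χ) (cj (t ^ (a + b + 2))))) (𝓝[≠] 0) (𝓝 0) := by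
    have := TW.mul tτ
    rw [mul_zero] at this
    refine this.congr' ?_
    filter_upwards [hne] with t ht
    field_simp
  have evn' := (TX.prodMk_nhds TW0).eventually hnorm'
  have evm := (tz.prodMk_nhds ((tendsto_const_nhds (x := χ)).prodMk_nhds tτ)).eventually hmapχ
  have evm0 := ((tendsto_const_nhds (x := (0 : ℂ))).prodMk_nhds
    ((tendsto_const_nhds (x := χ)).prodMk_nhds tτ)).eventually hmapχ
  refine ⟨Tw, TQ, ?_, ?_, TW⟩
  · have hZ := tendsto_div_of_analyticAt hF hF0 tz Tw tendsto_pow_div_self TQN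
    rw [mul_one, mul_comm (pd F 0 1 0 0)] at hZ
    refine (hL' _ _ _ _ _ hZ TW TX).congr' ?_
    filter_upwards [evn', evm] with t h1 h2
    rw [h1, h2]
  · have hZ := tendsto_div_of_analyticAt hF hF0 tendsto_const_nhds tτ (u := 0) (by simp)
      (tendsto_pow_div_pow (m := a + b + 2) (n := a + b + 1) (by omega))
    rw [mul_zero, mul_zero, add_zero] at hZ
    have := hL' _ _ _ _ _ hZ TW TX
    rw [zero_pow (by omega), mul_zero, zero_mul] at this
    refine this.congr' ?_
    filter_upwards [evn', evm0, evn] with t h1 h2 h3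
    rw [h3] at h2
    rw [h1, h2]

theorem pd_eq_zero_of_tendsto {G : ℂ → ℂ → ℂ} (hG : AnalyticAt ℂ (fun p : ℂ × ℂ => G p.1 p.2) 0)
    {a b : ℕ} (hlim : ∀ α μ : ℕ, 1 ≤ α → (α + μ < a + b ∨ α + μ = a + b ∧ μ ≤ b) →
      Tendsto (fun t => (G (t ^ (α + μ + 1)) (t ^ (α + μ + 2)) - G 0 (t ^ (α + μ + 2))) /
        t ^ ((α + μ + 1) * (α + μ) + μ)) (𝓝[≠] 0) (𝓝 0)) (ha : 1 ≤ a) : pd G a b 0 0 = 0 := by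
  have hf : AnalyticAt ℂ (fun p : ℂ × ℂ × ℂ => G p.1 p.2.2) 0 := by
    have h : AnalyticAt ℂ (fun p : ℂ × ℂ × ℂ => (p.1, p.2.2)) 0 :=
      ((ContinuousLinearMap.fst ℂ ℂ (ℂ × ℂ)).prod
        ((ContinuousLinearMap.snd ℂ ℂ ℂ).comp (ContinuousLinearMap.snd ℂ ℂ (ℂ × ℂ)))).analyticAt 0
    exact AnalyticAt.fun_comp_of_eq (g := fun p : ℂ × ℂ => G p.1 p.2) hG h rfl
  have key : ∀ n α μ : ℕ, (α + μ) * (α + μ + 1) + μ = n → 1 ≤ α →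
      (α + μ < a + b ∨ α + μ = a + b ∧ μ ≤ b) → pd G α μ 0 0 = 0 := by
    intro n
    induction n using Nat.strong_induction_on with
    | _ n ih =>
      intro α μ hn hα hle
      have hv : VanishBelow (fun z _ τ => G z τ) α μ := by
        intro α' μ' hα' hlt
        refine Eventually.of_forall fun _ => ?_
        refine ih _ ?_ α' μ' rfl hα' (by omega)
        subst hn
        rcases hlt with h | ⟨h, h'⟩
        · nlinarith
        · rw [h]; omega
      have h1 := (tendsto_weighted hf hα hv).self_of_nhds (fun t => t ^ (α + μ + 1)) (fun _ => 0)
        (fun t => t ^ (α + μ + 2)) 1 1 tendsto_pow_div_self tendsto_pow_div_self tendsto_const_nhds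
      have h2 := tendsto_nhds_unique h1 (hlim α μ hα hle)
      have h3 : (α.factorial : ℂ) * μ.factorial ≠ 0 := by
        exact_mod_cast mul_ne_zero α.factorial_ne_zero μ.factorial_ne_zero
      rw [one_pow, one_pow, mul_one, mul_one, div_eq_zero_iff, or_iff_left h3] at h2
      exact h2
  exact key _ a b rfl ha (by omega)

theorem VanishBelow.mono {f : ℂ → ℂ → ℂ → ℂ} {a b α μ : ℕ} (h : VanishBelow f a b)
    (hle : α + μ < a + b ∨ α + μ = a + b ∧ μ ≤ b) : VanishBelow f α μ :=
  fun α' μ' hα' hlt => h α' μ' hα' (by omega)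

/-- The reflection identity at any order below which the invariants of both sides vanish. -/
theorem reflection_identity_of_vanishBelow {Q Q' : ℂ → ℂ → ℂ → ℂ} (hQ : IsNormalCoord Q)
    (hQ' : IsNormalCoord Q') {F G : ℂ → ℂ → ℂ} (h : SendsInto Q Q' F G) {a b : ℕ} (ha : 1 ≤ a)
    (hv : VanishBelow Q a b) (hv' : VanishBelow Q' a b) :
    pd G a b 0 0 = 0 ∧ ∀ᶠ χ : ℂ in 𝓝 0,
      pd G 0 1 0 0 * qd Q a b χ =
        qd Q' a b (cj (F (cj χ) 0)) *
          (pd F 1 0 0 0 + qd Q 1 0 χ * pd F 0 1 0 0) ^ a *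
          (pd G 0 1 0 0 - qd Q' 1 0 (cj (F (cj χ) 0)) * pd F 0 1 0 0) ^ b := by
  have hne : ∀ᶠ t : ℂ in 𝓝[≠] 0, t ≠ 0 := eventually_mem_nhdsWithin
  have tpow : ∀ n : ℕ, n ≠ 0 → Tendsto (fun t : ℂ => t ^ n) (𝓝[≠] 0) (𝓝 0) := fun n hn =>
    (tendsto_pow_punctured hn).mono_right nhdsWithin_le_nhds
  have hflat : ∀ α μ : ℕ, 1 ≤ α → (α + μ < a + b ∨ α + μ = a + b ∧ μ ≤ b) →
      Tendsto (fun t => (G (t ^ (α + μ + 1)) (t ^ (α + μ + 2)) - G 0 (t ^ (α + μ + 2))) /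
        t ^ ((α + μ + 1) * (α + μ) + μ)) (𝓝[≠] 0) (𝓝 0) := by
    intro α μ hα hle
    obtain ⟨-, -, h1, h0, -⟩ :=
      (tendsto_reflection hQ hQ' h hα (hv.mono hle) (hv'.mono hle)).self_of_nhds
    rw [cj_zero, h.2.2.1, cj_zero, qd_zero_of_normal hQ'.2.1 hα, zero_div, zero_mul, zero_mul]
      at h1
    rw [cj_zero] at h0
    have h2 := h1.sub h0
    rw [sub_zero] at h2
    refine h2.congr' ?_
    filter_upwards [((tpow (α + μ + 1) (by omega)).prodMk_nhds
      (tpow (α + μ + 2) (by omega))).eventually hQ.2.1] with t ht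
    rw [← sub_div, sub_sub_sub_cancel_right, ht]
  refine ⟨pd_eq_zero_of_tendsto h.2.1 hflat ha, ?_⟩
  have hfac : (a.factorial : ℂ) * b.factorial ≠ 0 := by
    exact_mod_cast mul_ne_zero a.factorial_ne_zero b.factorial_ne_zero
  have hGz := (map_zero_second hQ hQ' h).self_of_nhds
  have tcj : Tendsto cj (𝓝 0) (𝓝 0) := continuous_cj.tendsto' _ _ cj_zero
  have tf : Tendsto (fun χ => cj (F (cj χ) 0)) (𝓝 0) (𝓝 0) := by
    have tcj0 : Tendsto (fun χ => (cj χ, (0 : ℂ))) (𝓝 0) (𝓝 0) :=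
      tcj.prodMk_nhds tendsto_const_nhds
    have := (continuous_cj.tendsto _).comp (h.1.continuousAt.tendsto.comp tcj0)
    simpa [Function.comp_def, h.2.2.1] using this
  have hq10 : ∀ᶠ χ : ℂ in 𝓝 0, 1 < a + b → qd Q' 1 0 (cj (F (cj χ) 0)) = 0 := by
    by_cases hk : 1 < a + b
    · filter_upwards [tf.eventually (hv' 1 0 le_rfl (Or.inl hk))] with χ h _ using h
    · simp [hk]
  filter_upwards [tendsto_reflection hQ hQ' h ha hv hv', hq10] with χ ⟨Tw, TQ, T1, T0, TW⟩ hq10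
  have hderiv : cj (deriv (G (cj χ)) 0) ^ b =
      (pd G 0 1 0 0 - qd Q' 1 0 (cj (F (cj χ) 0)) * pd F 0 1 0 0) ^ b := by
    rcases Nat.eq_zero_or_pos b with hb | hb
    · subst hb; simp
    rw [hq10 (by omega), zero_mul, sub_zero]
    congr 1
    have e1 : Tendsto (fun t => (G 0 (t ^ (a + b + 2)) - cj (G (cj χ) (cj (t ^ (a + b + 2))))) /
        t ^ (a + b + 2)) (𝓝[≠] 0) (𝓝 0) := by
      have := T0.mul (tendsto_pow_div_pow (m := (a + b + 1) * (a + b) + b) (n := a + b + 2)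
        (by nlinarith))
      rw [mul_zero] at this
      refine this.congr' ?_
      filter_upwards [hne] with t ht
      field_simp
    have e2 := tendsto_div_of_analyticAt h.2.1 hGz tendsto_const_nhds (tpow (a + b + 2) (by omega))
      (u := 0) (by simp) tendsto_pow_div_self
    rw [mul_zero, zero_add, mul_one] at e2
    have e3 := e2.sub e1
    rw [sub_zero] at e3
    refine tendsto_nhds_unique TW (e3.congr fun t => ?_)
    rw [← sub_div, sub_sub_cancel]
  rw [← hderiv]
  have D : Tendsto (fun t => (G (t ^ (a + b + 1)) (Q (t ^ (a + b + 1)) χ (t ^ (a + b + 2))) -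
      G (t ^ (a + b + 1)) (t ^ (a + b + 2))) / t ^ ((a + b + 1) * (a + b) + b)) (𝓝[≠] 0)
      (𝓝 (pd G 0 1 0 0 * (qd Q a b χ / (a.factorial * b.factorial)))) := by
    have hs := h.2.1.hasStrictFDerivAt.isLittleO
    have hp : Tendsto (fun t : ℂ => (((t ^ (a + b + 1),
        Q (t ^ (a + b + 1)) χ (t ^ (a + b + 2))) : ℂ × ℂ),
        ((t ^ (a + b + 1), t ^ (a + b + 2)) : ℂ × ℂ))) (𝓝[≠] 0) (𝓝 (0, 0)) :=
      ((tpow _ (by omega)).prodMk_nhds Tw).prodMk_nhds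
        ((tpow _ (by omega)).prodMk_nhds (tpow _ (by omega)))
    have hs1 := hs.comp_tendsto hp
    have hO : (fun t => Q (t ^ (a + b + 1)) χ (t ^ (a + b + 2)) - t ^ (a + b + 2)) =O[𝓝[≠] 0]
        fun t : ℂ => t ^ ((a + b + 1) * (a + b) + b) := by
      refine Asymptotics.isBigO_of_div_tendsto_nhds ?_ _ TQ
      filter_upwards [hne] with t ht h0
      exact absurd h0 (pow_ne_zero _ ht)
    have hs2 := (hs1.trans_isBigO (Asymptotics.IsBigO.trans
      (g := fun t => Q (t ^ (a + b + 1)) χ (t ^ (a + b + 2)) - t ^ (a + b + 2))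
      (Asymptotics.isBigO_of_le _ fun t => by simp) hO)).tendsto_div_nhds_zero
    have := hs2.add (TQ.const_mul (pd G 0 1 0 0))
    rw [zero_add] at this
    refine this.congr fun t => ?_
    simp only [Function.comp, Prod.mk_sub_mk, sub_self, fderiv_apply_eq_pd h.2.1]
    ring
  have hf := hflat a b ha (Or.inr ⟨rfl, le_rfl⟩)
  have L1 := (D.add hf).add T0
  rw [add_zero, add_zero] at L1
  have hfin := tendsto_nhds_unique (L1.congr fun t => by
    rw [← add_div, ← add_div, sub_add_sub_cancel, sub_add_sub_cancel]) T1
  field_simp at hfin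
  exact (div_left_inj' hfac).1 hfin

theorem IsInvariants.vanishBelow {Q : ℂ → ℂ → ℂ → ℂ} {a b : ℕ} (h : IsInvariants Q a b) :
    VanishBelow Q a b := by
  intro α μ hα hlt
  by_contra hcon
  have h1 := h.2.2.1 α μ hα hcon
  have h2 := h.2.2.2 α μ hα hcon
  omega

/-- identity (17)/(19): for a local biholomorphism `H = (F, G)` sending
`M` into `M'` (both non-Levi-flat), the invariants agree, `∂_z^{α₀}∂_w^{μ₀} G(0) = 0`,
and `∂_wG(0)·q_{α₀μ₀}(χ) = q'_{α₀μ₀}(F̄(χ,0))·(∂_zF(0) + q₁₀(χ)∂_wF(0))^{α₀}·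
(∂_wG(0) − q'₁₀(F̄(χ,0))∂_wF(0))^{μ₀}` for `χ` near `0`. -/
theorem basic_reflection_identity
    (Q Q' : ℂ → ℂ → ℂ → ℂ) (hQ : IsNormalCoord Q) (hQ' : IsNormalCoord Q')
    (hLF : NotLeviFlat Q) (hLF' : NotLeviFlat Q')
    (α₀ μ₀ α₀' μ₀' : ℕ) (hI : IsInvariants Q α₀ μ₀) (hI' : IsInvariants Q' α₀' μ₀')
    (F G : ℂ → ℂ → ℂ) (h : SendsInto Q Q' F G) (hb : JacDet F G ≠ 0) :
    α₀ = α₀' ∧ μ₀ = μ₀' ∧ pd G α₀ μ₀ 0 0 = 0 ∧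
    ∀ᶠ χ : ℂ in 𝓝 0,
      pd G 0 1 0 0 * qd Q α₀ μ₀ χ =
        qd Q' α₀ μ₀ (cj (F (cj χ) 0)) *
          (pd F 1 0 0 0 + qd Q 1 0 χ * pd F 0 1 0 0) ^ α₀ *
          (pd G 0 1 0 0 - qd Q' 1 0 (cj (F (cj χ) 0)) * pd F 0 1 0 0) ^ μ₀ := by
  have hv := hI.vanishBelow
  have hv' := hI'.vanishBelow
  have hA0 : pd G 1 0 0 0 = 0 := by
    have : (fun z => G z 0) =ᶠ[𝓝 0] fun _ => 0 := map_zero_second hQ hQ' h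
    exact this.deriv_eq.trans (deriv_const _ _)
  rw [JacDet, hA0, mul_zero, sub_zero] at hb
  obtain ⟨hA, hC⟩ := mul_ne_zero_iff.1 hb
  have tcj : Tendsto cj (𝓝 0) (𝓝 0) := continuous_cj.tendsto' _ _ cj_zero
  have tcj0 : Tendsto (fun χ => (cj χ, (0 : ℂ))) (𝓝 0) (𝓝 0) := tcj.prodMk_nhds tendsto_const_nhds
  have tf : Tendsto (fun χ => cj (F (cj χ) 0)) (𝓝 0) (𝓝 0) := by
    have := (continuous_cj.tendsto _).comp (h.1.continuousAt.tendsto.comp tcj0)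
    simpa [Function.comp_def, h.2.2.1] using this
  by_cases hlt : α₀ + μ₀ < α₀' + μ₀' ∨ α₀ + μ₀ = α₀' + μ₀' ∧ μ₀ < μ₀'
  · exfalso
    have hid := (reflection_identity_of_vanishBelow hQ hQ' h hI.1 hv (hv'.mono (by omega))).2
    refine hI.2.1 ?_
    filter_upwards [hid, tf.eventually (hv' α₀ μ₀ hI.1 hlt)] with χ h1 h2
    rw [h2, zero_mul, zero_mul, mul_eq_zero] at h1
    exact h1.resolve_left hC
  by_cases hgt : α₀' + μ₀' < α₀ + μ₀ ∨ α₀' + μ₀' = α₀ + μ₀ ∧ μ₀' < μ₀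
  · exfalso
    have hid := (reflection_identity_of_vanishBelow hQ hQ' h hI'.1 (hv.mono (by omega)) hv').2
    have c1 : Tendsto (fun χ => pd F 1 0 0 0 + qd Q 1 0 χ * pd F 0 1 0 0) (𝓝 0)
        (𝓝 (pd F 1 0 0 0)) := by
      have := ((analyticAt_qd hQ.1 1 0).2.continuousAt.tendsto.mul_const (pd F 0 1 0 0)).const_add
        (pd F 1 0 0 0)
      rwa [qd_zero_of_normal hQ.2.1 le_rfl, zero_mul, add_zero] at this
    have c2 : Tendsto (fun χ => pd G 0 1 0 0 - qd Q' 1 0 (cj (F (cj χ) 0)) * pd F 0 1 0 0) (𝓝 0)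
        (𝓝 (pd G 0 1 0 0)) := by
      have := (((analyticAt_qd hQ'.1 1 0).2.continuousAt.tendsto.comp tf).mul_const
        (pd F 0 1 0 0)).const_sub (pd G 0 1 0 0)
      rwa [qd_zero_of_normal hQ'.2.1 le_rfl, zero_mul, sub_zero] at this
    have hzero : ∀ᶠ χ : ℂ in 𝓝 0, qd Q' α₀' μ₀' (cj (F (cj χ) 0)) = 0 := by
      filter_upwards [hid, hv α₀' μ₀' hI'.1 hgt, c1.eventually_ne hA, c2.eventually_ne hC]
        with χ h1 h2 h3 h4
      rw [h2, mul_zero, eq_comm, mul_eq_zero, mul_eq_zero] at h1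
      exact (h1.resolve_right (pow_ne_zero _ h4)).resolve_right (pow_ne_zero _ h3)
    refine hI'.2.1 ?_
    have hF1 : AnalyticAt ℂ (fun z => F z 0) 0 :=
      AnalyticAt.fun_comp_of_eq (g := fun p : ℂ × ℂ => F p.1 p.2) (f := fun z : ℂ => (z, (0 : ℂ)))
        h.1 (analyticAt_id.prod analyticAt_const) rfl
    have hmap := hF1.hasStrictDerivAt.map_nhds_eq hA
    rw [h.2.2.1] at hmap
    have h1 : ∀ᶠ χ : ℂ in 𝓝 0, qd Q' α₀' μ₀' (cj (F χ 0)) = 0 := by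
      filter_upwards [tcj.eventually hzero] with χ hχ
      rwa [cj_cj] at hχ
    have h2 : ∀ᶠ χ : ℂ in 𝓝 0, qd Q' α₀' μ₀' (cj χ) = 0 := by
      rw [← hmap]
      exact h1
    filter_upwards [tcj.eventually h2] with χ hχ
    rwa [cj_cj] at hχ
  obtain ⟨rfl, rfl⟩ : α₀ = α₀' ∧ μ₀ = μ₀' := by omega
  exact ⟨rfl, rfl, reflection_identity_of_vanishBelow hQ hQ' h hI.1 hv hv'⟩
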